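/- Every graph G with maximum degree Δ ≥ 24 is acyclically k-choosable for every integer k with k ≥ (3/2)·Δ^(4/3) + 5Δ − 15; that is, for every assignment of color lists of size k to the vertices of G there exists an acyclic coloring of G in which every vertex receives a color from its own list. -/

import Mathlib

/-- A coloring is an acyclic coloring of `G` if it is proper and every cycle of `G`
receives at least 3 distinct colors (i.e. no cycle is colored with only two colors). -/
def IsAcyclicColoring {V : Type} (G : SimpleGraph V) {α : Type} [DecidableEq α]
    (c : V → α) : Prop :=
  (∀ u v, G.Adj u v → c u ≠ c v) ∧
  ∀ (v : V) (w : G.Walk v v), w.IsCycle → 3 ≤ (w.support.map c).toFinset.card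

theorem list_size_bound {x : ℝ} (hx : 24 ≤ x ^ 3) :
    (x ^ 2 + x) ^ 2 / 2 + x ^ 3 + (x ^ 3 * x ^ 3) / (x ^ 2 + x)
      + x ^ 3 * (x ^ 3 * (x ^ 3 * (x ^ 3 * ((x ^ 2 + x) * (1 / ((x ^ 2 + x) ^ 2 / 2) ^ 3)))))
      + x ^ 3 * (x ^ 3 * (x ^ 3 * (x ^ 3 * (x ^ 3 * (x ^ 3 * (1 / ((x ^ 2 + x) ^ 2 / 2) ^ 4))))))
      ≤ 3 / 2 * x ^ 4 + 5 * x ^ 3 - 15 := by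
  have hx2 : 2.88 ≤ x := by
    by_contra! h
    rcases le_or_gt x 0 with h0 | h0
    · nlinarith [sq_nonneg x, mul_nonneg (neg_nonneg.2 h0) (sq_nonneg x)]
    · have : x ^ 3 < 2.88 ^ 3 := by gcongr
      norm_num at this
      linarith
  have h0 : 0 < x := by linarith
  obtain ⟨r, hr⟩ : ∃ r, r = x / (x + 1) := ⟨_, rfl⟩
  have hr0 : 0 ≤ r := by rw [hr]; positivity
  have hr1 : r ≤ 1 := by rw [hr, div_le_one (by positivity)]; linarith
  have e1 : (x ^ 3 * x ^ 3) / (x ^ 2 + x) ≤ x ^ 4 - x ^ 3 + x ^ 2 := by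
    rw [div_le_iff₀ (by positivity)]
    nlinarith [pow_pos h0 3]
  have e2 : x ^ 3 * (x ^ 3 * (x ^ 3 * (x ^ 3 * ((x ^ 2 + x) * (1 / ((x ^ 2 + x) ^ 2 / 2) ^ 3)))))
      = 8 * x ^ 2 * r ^ 5 := by
    rw [hr]; field_simp; ring
  have e3 : x ^ 3 * (x ^ 3 * (x ^ 3 * (x ^ 3 * (x ^ 3 * (x ^ 3 *
      (1 / ((x ^ 2 + x) ^ 2 / 2) ^ 4)))))) = 16 * x ^ 2 * r ^ 8 := by
    rw [hr]; field_simp; ring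
  rw [e2, e3]
  have key : 8 * x ^ 2 * r ^ 5 + 16 * x ^ 2 * r ^ 8 + 3 / 2 * x ^ 2 ≤ 4 * x ^ 3 - 15 := by
    have bound : ∀ q : ℝ, r ≤ q →
        8 * x ^ 2 * r ^ 5 + 16 * x ^ 2 * r ^ 8 ≤ x ^ 2 * (8 * q ^ 5 + 16 * q ^ 8) := by
      intro q hq
      have h5 : r ^ 5 ≤ q ^ 5 := by gcongr
      have h8 : r ^ 8 ≤ q ^ 8 := by gcongr
      nlinarith [sq_nonneg x]
    rcases le_or_gt x 4 with h4 | h4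
    · have := bound 0.8 (by rw [hr, div_le_iff₀ (by positivity)]; linarith)
      norm_num at this
      nlinarith [sq_nonneg x]
    rcases le_or_gt x 7 with h7 | h7
    · have := bound 0.875 (by rw [hr, div_le_iff₀ (by positivity)]; linarith)
      norm_num at this
      nlinarith [sq_nonneg x]
    · have := bound 1 hr1
      norm_num at this
      nlinarith [sq_nonneg x]
  nlinarith

/-- `c` is proper on `S`, gives distinct colors to distinct vertices of `S` with at least `y`
common neighbors, and leaves no cycle inside `S` with fewer than three colors. -/
structure SimpleGraph.IsGoodOn {V : Type} [Fintype V] [DecidableEq V] (G : SimpleGraph V)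
    [DecidableRel G.Adj] (y : ℝ) (S : Finset V) (c : V → ℕ) : Prop where
  proper : ∀ u ∈ S, ∀ w ∈ S, G.Adj u w → c u ≠ c w
  codegree : ∀ u ∈ S, ∀ w ∈ S, u ≠ w →
    y ≤ (G.neighborFinset u ∩ G.neighborFinset w).card → c u ≠ c w
  cycle : ∀ (v : V) (w : G.Walk v v), w.IsCycle → (∀ x ∈ w.support, x ∈ S) →
    3 ≤ (w.support.map c).toFinset.card

/-- In a cycle with at most two colors whose consecutive vertices have distinct colors, the colors
alternate and the length is even. -/
lemma SimpleGraph.Walk.colors_alternate {V : Type} {G : SimpleGraph V} {v : V}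
    {c : V → ℕ} {w : G.Walk v v} (hw : w.IsCycle)
    (hc : ∀ i < w.length, c (w.getVert i) ≠ c (w.getVert (i + 1)))
    (h3 : (w.support.map c).toFinset.card < 3) :
    (∀ i, i + 2 ≤ w.length → c (w.getVert (i + 2)) = c (w.getVert i)) ∧ Even w.length := by
  have hl := hw.three_le_length
  have two : ∀ i, c (w.getVert i) = c (w.getVert 0) ∨ c (w.getVert i) = c (w.getVert 1) := by
    intro i
    by_contra! h
    have hsub : ({c (w.getVert 0), c (w.getVert 1), c (w.getVert i)} : Finset ℕ) ⊆
        (w.support.map c).toFinset := by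
      intro a ha
      simp only [Finset.mem_insert, Finset.mem_singleton] at ha
      simp only [List.mem_toFinset, List.mem_map]
      rcases ha with rfl | rfl | rfl <;> exact ⟨_, w.getVert_mem_support _, rfl⟩
    have := Finset.card_le_card hsub
    rw [Finset.card_eq_three.2 ⟨_, _, _, hc 0 (by lia), h.1.symm, h.2.symm, rfl⟩] at this
    lia
  have par : ∀ i ≤ w.length, c (w.getVert i) = c (w.getVert (i % 2)) := by
    intro i
    induction i with
    | zero => simp
    | succ i ih =>
      intro hi
      have h1 := ih (by lia)
      have h2 := hc i (by lia)
      have h3 := two (i + 1)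
      rcases Nat.mod_two_eq_zero_or_one i with h | h
      · have h' : (i + 1) % 2 = 1 := by lia
        rw [h] at h1
        rw [h']
        grind
      · have h' : (i + 1) % 2 = 0 := by lia
        rw [h] at h1
        rw [h']
        grind
  refine ⟨fun i hi => by rw [par _ hi, par i (by lia), Nat.add_mod_right], ?_⟩
  · rw [Nat.even_iff]
    by_contra h
    have h1 := par w.length le_rfl
    rw [Nat.mod_two_ne_zero.1 h] at h1
    have h2 := hc 0 (by lia)
    simp only [getVert_length, getVert_zero, zero_add] at h1 h2
    exact h2 h1

open Classical in
/-- The number of elements of `t` satisfying `p`. -/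
noncomputable def Finset.countSat {κ : Type*} (t : Finset κ) (p : κ → Prop) : ℕ :=
  (t.filter p).card

lemma Finset.countSat_exists_le_sum {ι κ : Type*} {s : Finset ι} {t : Finset κ}
    {p : ι → κ → Prop} {f : ι → ℝ} (h : ∀ i ∈ s, (t.countSat (p i) : ℝ) ≤ f i) :
    (t.countSat (fun x => ∃ i ∈ s, p i x) : ℝ) ≤ ∑ i ∈ s, f i := by
  classical
  have hle : t.countSat (fun x => ∃ i ∈ s, p i x) ≤ ∑ i ∈ s, t.countSat (p i) := by
    unfold countSat
    refine (card_le_card fun x hx => ?_).trans card_biUnion_le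
    simp only [mem_filter, mem_biUnion] at hx ⊢
    tauto
  calc (t.countSat (fun x => ∃ i ∈ s, p i x) : ℝ)
      ≤ ∑ i ∈ s, (t.countSat (p i) : ℝ) := mod_cast hle
    _ ≤ ∑ i ∈ s, f i := sum_le_sum h

lemma Finset.countSat_exists_le_mul {ι κ : Type*} {s : Finset ι} {t : Finset κ}
    {p : ι → κ → Prop} {n M : ℝ} (hs : (s.card : ℝ) ≤ n) (hM : 0 ≤ M)
    (h : ∀ i ∈ s, (t.countSat (p i) : ℝ) ≤ M) :
    (t.countSat (fun x => ∃ i ∈ s, p i x) : ℝ) ≤ n * M := by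
  refine (countSat_exists_le_sum h).trans ?_
  rw [sum_const, nsmul_eq_mul]
  gcongr

section

variable {V : Type} [Fintype V] [DecidableEq V] {G : SimpleGraph V} [DecidableRel G.Adj]
  {y : ℝ} {L : V → Finset ℕ} {S T : Finset V} {c c' : V → ℕ} {v : V}

lemma SimpleGraph.IsGoodOn.congr_of_subset (h : G.IsGoodOn y S c) (hT : T ⊆ S)
    (hc : ∀ x ∈ T, c' x = c x) : G.IsGoodOn y T c' where
  proper u hu w hw huw := by
    rw [hc u hu, hc w hw]
    exact h.proper u (hT hu) w (hT hw) huw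
  codegree u hu w hw huw hy := by
    rw [hc u hu, hc w hw]
    exact h.codegree u (hT hu) w (hT hw) huw hy
  cycle a w hw hs := by
    rw [List.map_congr_left fun x hx => hc x (hs x hx)]
    exact h.cycle a w hw fun x hx => hT (hs x hx)

/-- Colorings from the lists `L` on `D`, extended by `0`, which are good on `S`. -/
noncomputable def SimpleGraph.goodColorings (G : SimpleGraph V) [DecidableRel G.Adj] (y : ℝ)
    (L : V → Finset ℕ) (D S : Finset V) : Finset (V → ℕ) :=
  open Classical in
  (Fintype.piFinset fun v => if v ∈ D then L v else {0}).filter (G.IsGoodOn y S)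

lemma SimpleGraph.mem_goodColorings {D : Finset V} :
    c ∈ G.goodColorings y L D S ↔
      (∀ x ∈ D, c x ∈ L x) ∧ (∀ x ∉ D, c x = 0) ∧ G.IsGoodOn y S c := by
  simp only [goodColorings, Finset.mem_filter, Fintype.mem_piFinset, ← and_assoc]
  refine and_congr_left fun _ => ⟨fun h => ⟨fun x hx => ?_, fun x hx => ?_⟩, fun h x => ?_⟩
  · simpa [hx] using h x
  · simpa [hx] using h x
  · by_cases hx : x ∈ D
    · simpa [hx] using h.1 x hx
    · simpa [hx] using h.2 x hx

lemma SimpleGraph.goodColorings_empty_nonempty (L : V → Finset ℕ) :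
    (G.goodColorings y L ∅ ∅).Nonempty :=
  ⟨fun _ => 0, mem_goodColorings.2 ⟨by simp, by simp, by simp, by simp,
    fun v w _ h => absurd (h v w.start_mem_support) (by simp)⟩⟩

lemma SimpleGraph.mul_card_goodColorings_le {k : ℕ} (hL : (L v).card = k) (hv : v ∉ S) :
    k * (G.goodColorings y L S S).card ≤ (G.goodColorings y L (insert v S) S).card := by
  rw [← hL, mul_comm, ← Finset.card_product]
  refine Finset.card_le_card_of_injOn (fun p => Function.update p.1 v p.2) ?_ ?_
  · rintro ⟨c, a⟩ h
    simp only [Finset.coe_product, Set.mem_prod, Finset.mem_coe] at h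
    obtain ⟨h1, h2, h3⟩ := mem_goodColorings.1 h.1
    refine mem_goodColorings.2 ⟨fun x hx => ?_, fun x hx => ?_, h3.congr_of_subset subset_rfl ?_⟩
    · rcases eq_or_ne x v with rfl | hxv
      · simpa using h.2
      · simpa [hxv] using h1 x (Finset.mem_of_mem_insert_of_ne hx hxv)
    · rw [Finset.mem_insert, not_or] at hx
      simpa [hx.1] using h2 x hx.2
    · intro x hx
      exact Function.update_of_ne (ne_of_mem_of_not_mem hx hv) _ _
  · rintro ⟨c, a⟩ h ⟨c', a'⟩ h' heq
    simp only [Finset.coe_product, Set.mem_prod, Finset.mem_coe] at h h' heq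
    have ha : a = a' := by simpa using congrFun heq v
    refine Prod.ext (funext fun x => ?_) ha
    rcases eq_or_ne x v with rfl | hxv
    · exact ((mem_goodColorings.1 h.1).2.1 x hv).trans ((mem_goodColorings.1 h'.1).2.1 x hv).symm
    · simpa [hxv] using congrFun heq x

/-- Colorings in which each vertex of `insert v T` copies a vertex of `S \ T` are determined by
their restriction to `S \ T`. -/
lemma SimpleGraph.card_le_card_goodColorings_sdiff {A : Finset (V → ℕ)} (σ : V → V)
    (hA : A ⊆ G.goodColorings y L (insert v S) S)
    (hσ : ∀ r ∈ insert v T, σ r ∈ S \ T) (hc : ∀ c ∈ A, ∀ r ∈ insert v T, c r = c (σ r)) :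
    A.card ≤ (G.goodColorings y L (S \ T) (S \ T)).card := by
  refine Finset.card_le_card_of_injOn (fun c x => if x ∈ S \ T then c x else 0) ?_ ?_
  · intro c hcA
    obtain ⟨h1, h2, h3⟩ := mem_goodColorings.1 (hA hcA)
    refine mem_goodColorings.2 ⟨fun x hx => ?_, fun x hx => ?_,
      h3.congr_of_subset Finset.sdiff_subset fun x hx => ?_⟩
    · simpa only [hx, if_true] using h1 x (Finset.mem_insert_of_mem (Finset.sdiff_subset hx))
    · simp only [hx, if_false]
    · simp only [hx, if_true]
  · intro c hcA c' hcA' heq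
    have hS : ∀ x ∈ S \ T, c x = c' x := fun x hx => by
      simpa only [hx, if_true] using congrFun heq x
    funext x
    by_cases hx : x ∈ insert v T
    · rw [hc c hcA x hx, hc c' hcA' x hx, hS _ (hσ x hx)]
    by_cases hxS : x ∈ S
    · exact hS x (by simp_all)
    · have hx' : x ∉ insert v S := by simp_all
      rw [(mem_goodColorings.1 (hA hcA)).2.1 x hx', (mem_goodColorings.1 (hA hcA')).2.1 x hx']

lemma SimpleGraph.sum_codegree_le {Δ : ℕ} (hΔ : ∀ u, G.degree u ≤ Δ) (v : V) :
    ∑ u, (G.neighborFinset u ∩ G.neighborFinset v).card ≤ Δ * Δ := by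
  calc ∑ u, (G.neighborFinset u ∩ G.neighborFinset v).card
      = ∑ u, ∑ a ∈ G.neighborFinset v, if G.Adj u a then 1 else 0 := by
        refine Finset.sum_congr rfl fun u _ => ?_
        rw [← Finset.card_filter, Finset.inter_comm]
        congr 1
        ext a
        simp
    _ = ∑ a ∈ G.neighborFinset v, G.degree a := by
        rw [Finset.sum_comm]
        refine Finset.sum_congr rfl fun a _ => ?_
        rw [← Finset.card_filter, ← G.card_neighborFinset_eq_degree]
        congr 1
        ext u
        simp [G.adj_comm]
    _ ≤ ∑ a ∈ G.neighborFinset v, Δ := Finset.sum_le_sum fun a _ => hΔ a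
    _ ≤ Δ * Δ := by
        rw [Finset.sum_const, smul_eq_mul, G.card_neighborFinset_eq_degree]
        gcongr
        exact hΔ v

/-- `v` shares its color with a neighbor in `S`. -/
def SimpleGraph.AdjacentConflict (G : SimpleGraph V) [DecidableRel G.Adj] (S : Finset V) (v : V)
    (c : V → ℕ) : Prop :=
  ∃ u ∈ G.neighborFinset v, u ∈ S ∧ c v = c u

/-- `v` shares its color with a vertex `u` of `S` that has at least `y` common neighbors with `v`
or completes a two-colored `4`-cycle with `v`. -/
def SimpleGraph.DistanceTwoConflict (G : SimpleGraph V) [DecidableRel G.Adj] (y : ℝ)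
    (S : Finset V) (v : V) (c : V → ℕ) : Prop :=
  ∃ u ∈ Finset.univ,
    (y ≤ (G.neighborFinset u ∩ G.neighborFinset v).card ∧ u ∈ S ∧ c v = c u) ∨
    ((G.neighborFinset u ∩ G.neighborFinset v).card < y ∧
      ∃ P ∈ (G.neighborFinset u ∩ G.neighborFinset v).powersetCard 2,
        u ∈ S ∧ P ⊆ S ∧ c v = c u ∧ ∀ a ∈ P, ∀ b ∈ P, c a = c b)

/-- There is a two-colored `6`-cycle through `v`. -/
def SimpleGraph.SixCycleConflict (G : SimpleGraph V) [DecidableRel G.Adj] (y : ℝ)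
    (S : Finset V) (v : V) (c : V → ℕ) : Prop :=
  ∃ p₁ ∈ G.neighborFinset v, ∃ p₂ ∈ G.neighborFinset p₁, ∃ p₃ ∈ G.neighborFinset p₂,
    ∃ p₄ ∈ (G.neighborFinset p₃).filter fun p =>
      ((G.neighborFinset p ∩ G.neighborFinset v).card : ℝ) < y,
    ∃ p₅ ∈ G.neighborFinset p₄ ∩ G.neighborFinset v,
      [p₁, p₂, p₃, p₄, p₅].Nodup ∧ (∀ x ∈ [p₁, p₂, p₃, p₄, p₅], x ∈ S) ∧
      c v = c p₂ ∧ c p₃ = c p₁ ∧ c p₄ = c p₂ ∧ c p₅ = c p₁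

/-- There is a two-colored path on seven vertices starting at `v`. -/
def SimpleGraph.PathConflict (G : SimpleGraph V) [DecidableRel G.Adj] (S : Finset V) (v : V)
    (c : V → ℕ) : Prop :=
  ∃ p₁ ∈ G.neighborFinset v, ∃ p₂ ∈ G.neighborFinset p₁, ∃ p₃ ∈ G.neighborFinset p₂,
    ∃ p₄ ∈ G.neighborFinset p₃, ∃ p₅ ∈ G.neighborFinset p₄, ∃ p₆ ∈ G.neighborFinset p₅,
      [p₁, p₂, p₃, p₄, p₅, p₆].Nodup ∧ (∀ x ∈ [p₁, p₂, p₃, p₄, p₅, p₆], x ∈ S) ∧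
      c v = c p₂ ∧ c p₃ = c p₁ ∧ c p₄ = c p₂ ∧ c p₅ = c p₁ ∧ c p₆ = c p₂

lemma SimpleGraph.IsGoodOn.exists_conflict (h : G.IsGoodOn y S c)
    (hbad : ¬ G.IsGoodOn y (insert v S) c) :
    G.AdjacentConflict S v c ∨ G.DistanceTwoConflict y S v c ∨ G.SixCycleConflict y S v c ∨
      G.PathConflict S v c := by
  by_contra! hno
  obtain ⟨no₁, no₂₃, no₄, no₅⟩ := hno
  simp only [AdjacentConflict, DistanceTwoConflict, not_exists, not_and, not_or] at no₁ no₂₃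
  have no₂ : ∀ u ∈ S, y ≤ (G.neighborFinset u ∩ G.neighborFinset v).card → c v ≠ c u :=
    fun u hu hmy => (no₂₃ u (Finset.mem_univ u)).1 hmy hu
  have hprop : ∀ u ∈ insert v S, ∀ w ∈ insert v S, G.Adj u w → c u ≠ c w := by
    intro u hu w hw huw
    rcases Finset.mem_insert.1 hu with rfl | hu' <;>
      rcases Finset.mem_insert.1 hw with rfl | hw'
    · exact absurd huw (G.irrefl)
    · exact no₁ w (by simpa using huw) hw'
    · exact fun h' => no₁ u (by simpa using huw.symm) hu' h'.symm
    · exact h.proper u hu' w hw' huw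
  have hcodeg : ∀ u ∈ insert v S, ∀ w ∈ insert v S, u ≠ w →
      y ≤ (G.neighborFinset u ∩ G.neighborFinset w).card → c u ≠ c w := by
    intro u hu w hw huw hy
    rcases Finset.mem_insert.1 hu with rfl | hu' <;>
      rcases Finset.mem_insert.1 hw with rfl | hw'
    · exact absurd rfl huw
    · exact no₂ w hw' (by rwa [Finset.inter_comm])
    · exact (no₂ u hu' hy).symm
    · exact h.codegree u hu' w hw' huw hy
  refine hbad ⟨hprop, hcodeg, fun a w' hw' hs' => ?_⟩
  by_cases hv' : v ∈ w'.support
  swap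
  · exact h.cycle a w' hw' fun x hx =>
      Finset.mem_of_mem_insert_of_ne (hs' x hx) (ne_of_mem_of_not_mem hx hv')
  obtain ⟨w, hw⟩ : ∃ w, w = w'.rotate v hv' := ⟨_, rfl⟩
  have hmem : ∀ x, x ∈ w.support ↔ x ∈ w'.support := fun x => by
    rw [hw, Walk.mem_support_rotate_iff]
  have hcyc : w.IsCycle := hw ▸ hw'.rotate hv'
  have hcol : (w'.support.map c).toFinset = (w.support.map c).toFinset := by
    ext; simp [hmem]
  rw [hcol]
  by_contra! h3
  have hl := hcyc.three_le_length
  have hadj : ∀ i < w.length, G.Adj (w.getVert i) (w.getVert (i + 1)) := fun i hi =>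
    w.adj_getVert_succ hi
  have hin : ∀ i, w.getVert i ∈ insert v S := fun i =>
    hs' _ ((hmem _).1 (w.getVert_mem_support i))
  obtain ⟨halt, heven⟩ := Walk.colors_alternate hcyc
    (fun i hi => hprop _ (hin i) _ (hin _) (hadj i hi)) h3
  have hinj : ∀ i < w.length, ∀ j < w.length, i ≠ j → w.getVert i ≠ w.getVert j :=
    fun i hi j hj hij hp => hij (hcyc.getVert_injOn' (by simp; lia) (by simp; lia) hp)
  have h0 : w.getVert 0 = v := w.getVert_zero
  have hlast : w.getVert w.length = v := w.getVert_length
  have hS : ∀ i < w.length, i ≠ 0 → w.getVert i ∈ S := by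
    intro i hi hi0
    have := hinj i hi 0 (by lia) hi0
    rw [h0] at this
    exact Finset.mem_of_mem_insert_of_ne (hin i) this
  have hsmall : ∀ i < w.length, i ≠ 0 → c v = c (w.getVert i) →
      (G.neighborFinset (w.getVert i) ∩ G.neighborFinset v).card < y := by
    intro i hi hi0 hci
    by_contra! hy
    exact no₂ _ (hS i hi hi0) hy hci
  have hnb : ∀ i < w.length, w.getVert (i + 1) ∈ G.neighborFinset (w.getVert i) := fun i hi => by
    simpa using hadj i hi
  have hnb0 := hnb 0 (by lia)
  rw [h0] at hnb0
  have hnblast : w.getVert (w.length - 1) ∈ G.neighborFinset v := by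
    have := hadj (w.length - 1) (by lia)
    rw [Nat.sub_add_cancel (by lia), hlast] at this
    simpa using this.symm
  have c2 := (halt 0 (by lia)).symm
  rw [h0] at c2
  have c3 := halt 1 (by lia)
  obtain hlen | hlen | hlen : w.length = 4 ∨ w.length = 6 ∨ 8 ≤ w.length := by
    obtain ⟨m, hm⟩ := heven
    lia
  · rw [hlen] at hnblast
    refine (no₂₃ (w.getVert 2) (Finset.mem_univ _)).2 (hsmall 2 (by lia) (by lia) c2)
      {w.getVert 1, w.getVert 3} (Finset.mem_powersetCard.2
        ⟨?_, Finset.card_pair (hinj 1 (by lia) 3 (by lia) (by lia))⟩)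
      (hS 2 (by lia) (by lia)) ?_ c2 ?_
    · exact Finset.insert_subset
        (Finset.mem_inter.2 ⟨by simpa using (hadj 1 (by lia)).symm, hnb0⟩)
        (Finset.singleton_subset_iff.2 (Finset.mem_inter.2 ⟨hnb 2 (by lia), hnblast⟩))
    · exact Finset.insert_subset (hS 1 (by lia) (by lia))
        (Finset.singleton_subset_iff.2 (hS 3 (by lia) (by lia)))
    · simp [c3]
  · have c4 := (halt 2 (by lia))
    have c5 := (halt 3 (by lia)).trans c3
    rw [hlen] at hnblast
    refine no₄ ⟨_, hnb0, _, hnb 1 (by lia), _, hnb 2 (by lia), _,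
      Finset.mem_filter.2 ⟨hnb 3 (by lia), hsmall 4 (by lia) (by lia) (c2.trans c4.symm)⟩,
      w.getVert 5, Finset.mem_inter.2 ⟨hnb 4 (by lia), hnblast⟩, ?_, ?_, c2, c3, c4, c5⟩
    · rw [hlen] at hinj
      simp +arith [hinj]
    · rw [hlen] at hS
      simp [hS]
  · have c4 := (halt 2 (by lia))
    have c5 := (halt 3 (by lia)).trans c3
    have c6 := (halt 4 (by lia)).trans c4
    refine no₅ ⟨_, hnb0, _, hnb 1 (by lia), _, hnb 2 (by lia), _, hnb 3 (by lia), _,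
      hnb 4 (by lia), _, hnb 5 (by lia), ?_, ?_, c2, c3, c4, c5, c6⟩
    · have hinj' : ∀ i < 8, ∀ j < 8, i ≠ j → w.getVert i ≠ w.getVert j :=
        fun i hi j hj => hinj i (by lia) j (by lia)
      simp +arith [hinj']
    · have hS' : ∀ i < 8, i ≠ 0 → w.getVert i ∈ S := fun i hi => hS i (by lia)
      simp [hS']

lemma SimpleGraph.card_copying_le {p : (V → ℕ) → Prop} {β : ℝ} (hβ : 0 < β)
    (hN : ∀ T ⊆ S, β ^ T.card * (G.goodColorings y L (S \ T) (S \ T)).card ≤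
      (G.goodColorings y L S S).card) (n : ℕ)
    (hp : ∀ c, p c → ∃ T ⊆ S, T.card = n ∧ ∃ σ : V → V,
      (∀ r ∈ insert v T, σ r ∈ S \ T) ∧ ∀ c, p c → ∀ r ∈ insert v T, c r = c (σ r)) :
    ((G.goodColorings y L (insert v S) S).countSat p : ℝ) ≤
      1 / β ^ n * (G.goodColorings y L S S).card := by
  classical
  unfold Finset.countSat
  rcases ((G.goodColorings y L (insert v S) S).filter p).eq_empty_or_nonempty with h | ⟨c, hc⟩
  · rw [h, Finset.card_empty, Nat.cast_zero]
    positivity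
  obtain ⟨T, hT, rfl, σ, hσ, hcσ⟩ := hp c (Finset.mem_filter.1 hc).2
  rw [one_div, inv_mul_eq_div, le_div_iff₀' (by positivity)]
  refine le_trans (mul_le_mul_of_nonneg_left ?_ (by positivity)) (hN T hT)
  exact_mod_cast card_le_card_goodColorings_sdiff σ (Finset.filter_subset _ _) hσ
    fun c hc => hcσ c (Finset.mem_filter.1 hc).2

section

variable {β : ℝ} {Δ : ℕ}

lemma SimpleGraph.card_filter_eq_color_le (hβ : 0 < β) (u : V)
    (hN : ∀ T ⊆ S, β ^ T.card * (G.goodColorings y L (S \ T) (S \ T)).card ≤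
      (G.goodColorings y L S S).card) :
    ((G.goodColorings y L (insert v S) S).countSat (fun c => u ∈ S ∧ c v = c u) : ℝ) ≤
      (G.goodColorings y L S S).card := by
  have := card_copying_le (v := v) (p := fun c => u ∈ S ∧ c v = c u) hβ hN 0
    fun c hc => ⟨∅, by simp, rfl, fun _ => u, by simpa using hc.1, by simp⟩
  simpa using this

lemma SimpleGraph.card_adjacentConflict_le (hβ : 0 < β) (hΔ : ∀ u, G.degree u ≤ Δ)
    (hN : ∀ T ⊆ S, β ^ T.card * (G.goodColorings y L (S \ T) (S \ T)).card ≤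
      (G.goodColorings y L S S).card) :
    ((G.goodColorings y L (insert v S) S).countSat (G.AdjacentConflict S v) : ℝ) ≤
      Δ * (G.goodColorings y L S S).card :=
  Finset.countSat_exists_le_mul (by simpa using hΔ v) (by positivity)
    fun u _ => card_filter_eq_color_le hβ u hN

lemma SimpleGraph.card_distanceTwoConflict_le (hy : 0 < y) (hyβ : y ^ 2 = 2 * β)
    (hΔ : ∀ u, G.degree u ≤ Δ)
    (hN : ∀ T ⊆ S, β ^ T.card * (G.goodColorings y L (S \ T) (S \ T)).card ≤
      (G.goodColorings y L S S).card) :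
    ((G.goodColorings y L (insert v S) S).countSat (G.DistanceTwoConflict y S v) : ℝ) ≤
      Δ * Δ / y * (G.goodColorings y L S S).card := by
  have hβ : 0 < β := by nlinarith [pow_pos hy 2]
  obtain ⟨N, hNdef⟩ : ∃ N : ℝ, N = ((G.goodColorings y L S S).card : ℝ) := ⟨_, rfl⟩
  have hN0 : 0 ≤ N := by rw [hNdef]; positivity
  have hone : ∀ u, ((G.goodColorings y L (insert v S) S).countSat (fun c =>
      (y ≤ (G.neighborFinset u ∩ G.neighborFinset v).card ∧ u ∈ S ∧ c v = c u) ∨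
      ((G.neighborFinset u ∩ G.neighborFinset v).card < y ∧
        ∃ P ∈ (G.neighborFinset u ∩ G.neighborFinset v).powersetCard 2,
          u ∈ S ∧ P ⊆ S ∧ c v = c u ∧ ∀ a ∈ P, ∀ b ∈ P, c a = c b)) : ℝ) ≤
      (G.neighborFinset u ∩ G.neighborFinset v).card * (N / y) := by
    intro u
    obtain ⟨m, hm⟩ : ∃ m, m = (G.neighborFinset u ∩ G.neighborFinset v).card := ⟨_, rfl⟩
    rw [← hm]
    by_cases hmy : y ≤ m
    · simp only [hmy, hmy.not_gt, true_and, false_and, or_false]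
      refine (card_filter_eq_color_le hβ u hN).trans ?_
      rw [← hNdef, mul_div_assoc', le_div_iff₀ hy, mul_comm]
      gcongr
    · simp only [hmy, not_le.1 hmy, true_and, false_and, false_or]
      calc _ ≤ (m * (m - 1) / 2 : ℝ) * (1 / β ^ 1 * N) := by
            have hm2 : (m * (m - 1) / 2 : ℝ) = (m.choose 2 : ℕ) := (Nat.cast_choose_two ℝ m).symm
            refine Finset.countSat_exists_le_mul ?_ (by positivity) fun P hP => ?_
            · rw [Finset.card_powersetCard, ← hm, hm2]
            obtain ⟨hPsub, hPcard⟩ := Finset.mem_powersetCard.1 hP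
            obtain ⟨a, b, hab, rfl⟩ := Finset.card_eq_two.1 hPcard
            have ha := Finset.mem_inter.1 (hPsub (Finset.mem_insert_self a _))
            have hau : u ≠ a := (show G.Adj u a by simpa using ha.1).ne
            have hav : v ≠ a := (show G.Adj v a by simpa using ha.2).ne
            rw [hNdef]
            refine card_copying_le hβ hN 1 fun c hc => ?_
            obtain ⟨huS, hPS, -, -⟩ := hc
            refine ⟨{a}, Finset.singleton_subset_iff.2 (hPS (by simp)), by simp,
              fun r => if r = a then b else u, fun r _ => ?_, fun c hc r hr => ?_⟩
            · have hbS : b ∈ S := hPS (by simp)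
              rw [Finset.mem_sdiff, Finset.mem_singleton]
              grind
            · obtain ⟨-, -, h1, h2⟩ := hc
              have h3 := h2 a (by simp) b (by simp)
              rw [Finset.mem_insert, Finset.mem_singleton] at hr
              grind
        _ = m * (N / y) * ((m - 1) / y) := by
            have e : β = y ^ 2 / 2 := by linarith
            rw [e]
            field_simp
        _ ≤ m * (N / y) := by
            refine mul_le_of_le_one_right (by positivity) ?_
            rw [div_le_one hy]
            linarith
  rw [← hNdef]
  calc _ ≤ ∑ u, ((G.neighborFinset u ∩ G.neighborFinset v).card : ℝ) * (N / y) :=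
        Finset.countSat_exists_le_sum fun u _ => hone u
    _ = ((∑ u, (G.neighborFinset u ∩ G.neighborFinset v).card : ℕ) : ℝ) * (N / y) := by
        rw [← Finset.sum_mul]
        push_cast
        rfl
    _ ≤ ((Δ * Δ : ℕ) : ℝ) * (N / y) := by
        gcongr
        exact sum_codegree_le hΔ v
    _ = Δ * Δ / y * N := by push_cast; ring

lemma SimpleGraph.card_sixCycleConflict_le (hβ : 0 < β) (hy : 0 < y)
    (hΔ : ∀ u, G.degree u ≤ Δ) (hv : v ∉ S)
    (hN : ∀ T ⊆ S, β ^ T.card * (G.goodColorings y L (S \ T) (S \ T)).card ≤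
      (G.goodColorings y L S S).card) :
    ((G.goodColorings y L (insert v S) S).countSat (G.SixCycleConflict y S v) : ℝ) ≤
      Δ * (Δ * (Δ * (Δ * (y * (1 / β ^ 3 * (G.goodColorings y L S S).card))))) := by
  have hdeg : ∀ u, ((G.neighborFinset u).card : ℝ) ≤ Δ := fun u => by simpa using hΔ u
  refine Finset.countSat_exists_le_mul (hdeg _) (by positivity) fun p₁ _ => ?_
  refine Finset.countSat_exists_le_mul (hdeg _) (by positivity) fun p₂ _ => ?_
  refine Finset.countSat_exists_le_mul (hdeg _) (by positivity) fun p₃ _ => ?_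
  refine Finset.countSat_exists_le_mul
    (le_trans (mod_cast Finset.card_filter_le _ _) (hdeg p₃)) (by positivity) fun p₄ h₄ => ?_
  refine Finset.countSat_exists_le_mul (Finset.mem_filter.1 h₄).2.le (by positivity)
    fun p₅ _ => ?_
  refine card_copying_le hβ hN 3 fun c hc => ?_
  obtain ⟨hnd, hS, -⟩ := hc
  simp only [List.nodup_cons, List.mem_cons] at hnd
  refine ⟨{p₃, p₄, p₅}, ?_,
    Finset.card_eq_three.2 ⟨p₃, p₄, p₅, by tauto, by tauto, by tauto, rfl⟩,
    fun r => if r = v ∨ r = p₄ then p₂ else p₁, fun r _ => ?_, fun c hc r hr => ?_⟩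
  · intro x hx
    refine hS x ?_
    simp only [Finset.mem_insert, Finset.mem_singleton] at hx
    simp only [List.mem_cons]
    tauto
  · have h1 := hS p₁ (by simp)
    have h2 := hS p₂ (by simp)
    simp only [Finset.mem_sdiff, Finset.mem_insert, Finset.mem_singleton]
    grind
  · obtain ⟨-, -, e⟩ := hc
    have h3 : p₃ ≠ v := ne_of_mem_of_not_mem (hS p₃ (by simp)) hv
    have h5 : p₅ ≠ v := ne_of_mem_of_not_mem (hS p₅ (by simp)) hv
    simp only [Finset.mem_insert, Finset.mem_singleton] at hr
    grind

lemma SimpleGraph.card_pathConflict_le (hβ : 0 < β) (hΔ : ∀ u, G.degree u ≤ Δ) (hv : v ∉ S)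
    (hN : ∀ T ⊆ S, β ^ T.card * (G.goodColorings y L (S \ T) (S \ T)).card ≤
      (G.goodColorings y L S S).card) :
    ((G.goodColorings y L (insert v S) S).countSat (G.PathConflict S v) : ℝ) ≤
      Δ * (Δ * (Δ * (Δ * (Δ * (Δ * (1 / β ^ 4 * (G.goodColorings y L S S).card)))))) := by
  have hdeg : ∀ u, ((G.neighborFinset u).card : ℝ) ≤ Δ := fun u => by simpa using hΔ u
  refine Finset.countSat_exists_le_mul (hdeg _) (by positivity) fun p₁ _ => ?_
  refine Finset.countSat_exists_le_mul (hdeg _) (by positivity) fun p₂ _ => ?_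
  refine Finset.countSat_exists_le_mul (hdeg _) (by positivity) fun p₃ _ => ?_
  refine Finset.countSat_exists_le_mul (hdeg _) (by positivity) fun p₄ _ => ?_
  refine Finset.countSat_exists_le_mul (hdeg _) (by positivity) fun p₅ _ => ?_
  refine Finset.countSat_exists_le_mul (hdeg _) (by positivity) fun p₆ _ => ?_
  refine card_copying_le hβ hN 4 fun c hc => ?_
  obtain ⟨hnd, hS, -⟩ := hc
  simp only [List.nodup_cons, List.mem_cons] at hnd
  refine ⟨{p₃, p₄, p₅, p₆}, ?_, ?_,
    fun r => if r = v ∨ r = p₄ ∨ r = p₆ then p₂ else p₁, fun r _ => ?_, fun c hc r hr => ?_⟩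
  · intro x hx
    refine hS x ?_
    simp only [Finset.mem_insert, Finset.mem_singleton] at hx
    simp only [List.mem_cons]
    tauto
  · rw [Finset.card_insert_of_notMem (by grind),
      Finset.card_eq_three.2 ⟨p₄, p₅, p₆, by grind, by grind, by grind, rfl⟩]
  · have h1 := hS p₁ (by simp)
    have h2 := hS p₂ (by simp)
    simp only [Finset.mem_sdiff, Finset.mem_insert, Finset.mem_singleton]
    grind
  · obtain ⟨-, -, e⟩ := hc
    have h3 : p₃ ≠ v := ne_of_mem_of_not_mem (hS p₃ (by simp)) hv
    have h5 : p₅ ≠ v := ne_of_mem_of_not_mem (hS p₅ (by simp)) hv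
    simp only [Finset.mem_insert, Finset.mem_singleton] at hr
    grind

lemma SimpleGraph.mul_card_goodColorings_le_insert {k : ℕ} (hy : 0 < y) (hyβ : y ^ 2 = 2 * β)
    (hΔ : ∀ u, G.degree u ≤ Δ) (hL : ∀ u, (L u).card = k) (hv : v ∉ S)
    (hk : β + Δ + (Δ * Δ) / y + Δ * (Δ * (Δ * (Δ * (y * (1 / β ^ 3)))))
      + Δ * (Δ * (Δ * (Δ * (Δ * (Δ * (1 / β ^ 4)))))) ≤ k)
    (hN : ∀ T ⊆ S, β ^ T.card * (G.goodColorings y L (S \ T) (S \ T)).card ≤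
      (G.goodColorings y L S S).card) :
    β * (G.goodColorings y L S S).card ≤
      (G.goodColorings y L (insert v S) (insert v S)).card := by
  classical
  have hβ : 0 < β := by nlinarith [pow_pos hy 2]
  have b₁ := card_adjacentConflict_le (v := v) hβ hΔ hN
  have b₂ := card_distanceTwoConflict_le (v := v) hy hyβ hΔ hN
  have b₃ := card_sixCycleConflict_le hβ hy hΔ hv hN
  have b₄ := card_pathConflict_le hβ hΔ hv hN
  have hext : (k : ℝ) * (G.goodColorings y L S S).card ≤
      (G.goodColorings y L (insert v S) S).card :=
    mod_cast mul_card_goodColorings_le (hL v) hv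
  have hcard : (G.goodColorings y L (insert v S) S).card ≤
      (G.goodColorings y L (insert v S) (insert v S)).card +
        ((G.goodColorings y L (insert v S) S).countSat (G.AdjacentConflict S v) +
        ((G.goodColorings y L (insert v S) S).countSat (G.DistanceTwoConflict y S v) +
        ((G.goodColorings y L (insert v S) S).countSat (G.SixCycleConflict y S v) +
        (G.goodColorings y L (insert v S) S).countSat (G.PathConflict S v)))) := by
    unfold Finset.countSat
    refine (Finset.card_le_card fun c hc => ?_).trans ((Finset.card_union_le _ _).trans
      (Nat.add_le_add_left ((Finset.card_union_le _ _).trans (Nat.add_le_add_left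
      ((Finset.card_union_le _ _).trans (Nat.add_le_add_left (Finset.card_union_le _ _) _)) _)) _))
    obtain ⟨h1, h2, h3⟩ := mem_goodColorings.1 hc
    simp only [Finset.mem_union, Finset.mem_filter, hc, true_and]
    by_cases hgood : G.IsGoodOn y (insert v S) c
    · exact Or.inl (mem_goodColorings.2 ⟨h1, h2, hgood⟩)
    · exact Or.inr (h3.exists_conflict hgood)
  have hcard' : ((G.goodColorings y L (insert v S) S).card : ℝ) ≤ _ := Nat.cast_le.2 hcard
  push_cast at hcard'
  have hkN := mul_le_mul_of_nonneg_right hk (Nat.cast_nonneg (α := ℝ)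
    (G.goodColorings y L S S).card)
  linarith

/-- Each further vertex multiplies the number of good colorings by at least `β`. -/
lemma SimpleGraph.pow_mul_card_goodColorings_sdiff_le {k : ℕ} (hy : 0 < y)
    (hyβ : y ^ 2 = 2 * β) (hΔ : ∀ u, G.degree u ≤ Δ) (hL : ∀ u, (L u).card = k)
    (hk : β + Δ + (Δ * Δ) / y + Δ * (Δ * (Δ * (Δ * (y * (1 / β ^ 3)))))
      + Δ * (Δ * (Δ * (Δ * (Δ * (Δ * (1 / β ^ 4)))))) ≤ k) (S : Finset V) :
    ∀ T ⊆ S, β ^ T.card * (G.goodColorings y L (S \ T) (S \ T)).card ≤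
      (G.goodColorings y L S S).card := by
  have hβ : 0 < β := by nlinarith [pow_pos hy 2]
  induction S using Finset.strongInduction with
  | H S ih =>
    intro T hT
    rcases T.eq_empty_or_nonempty with rfl | ⟨v, hvT⟩
    · simp
    have hvS := hT hvT
    have ih' := ih _ (Finset.erase_ssubset hvS)
    have hstep := mul_card_goodColorings_le_insert hy hyβ hΔ hL (Finset.notMem_erase v S) hk ih'
    rw [Finset.insert_erase hvS] at hstep
    refine le_trans ?_ hstep
    have hsd : S \ T = S.erase v \ T.erase v := by
      ext x; simp only [Finset.mem_sdiff, Finset.mem_erase]; grind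
    rw [hsd, ← Finset.card_erase_add_one hvT, pow_succ', mul_assoc]
    gcongr
    exact ih' _ (Finset.erase_subset_erase v hT)

end

end

theorem stmt3 {V : Type} [Fintype V] (G : SimpleGraph V) [DecidableRel G.Adj]
    (Δ : ℕ) (hΔ : G.maxDegree = Δ) (h24 : 24 ≤ Δ) (k : ℕ)
    (hk : (3 / 2) * (Δ : ℝ) ^ ((4 : ℝ) / 3) + 5 * (Δ : ℝ) - 15 ≤ (k : ℝ)) :
    ∀ L : V → Finset ℕ, (∀ v, (L v).card = k) →
      ∃ c : V → ℕ, (∀ v, c v ∈ L v) ∧ IsAcyclicColoring G c := by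
  classical
  intro L hL
  obtain ⟨x, hx⟩ : ∃ x : ℝ, x = (Δ : ℝ) ^ ((1 : ℝ) / 3) := ⟨_, rfl⟩
  have hΔ0 : (0 : ℝ) < Δ := by
    have : 0 < Δ := by lia
    exact_mod_cast this
  have hx0 : 0 < x := hx ▸ Real.rpow_pos_of_pos hΔ0 _
  have hx3 : x ^ 3 = Δ := by
    rw [hx, ← Real.rpow_natCast, ← Real.rpow_mul hΔ0.le]
    norm_num
  have hx4 : (Δ : ℝ) ^ ((4 : ℝ) / 3) = x ^ 4 := by
    rw [hx, ← Real.rpow_natCast, ← Real.rpow_mul hΔ0.le]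
    norm_num
  have hnum := list_size_bound (x := x) (by rw [hx3]; exact_mod_cast h24)
  rw [hx4] at hk
  rw [hx3] at hnum
  have hpow := SimpleGraph.pow_mul_card_goodColorings_sdiff_le (G := G) (L := L)
    (y := x ^ 2 + x) (β := (x ^ 2 + x) ^ 2 / 2) (by positivity) (by ring)
    (fun u => hΔ ▸ G.degree_le_maxDegree u) hL (hnum.trans hk) Finset.univ Finset.univ subset_rfl
  rw [sdiff_self] at hpow
  have hpos : (0 : ℝ) < (G.goodColorings (x ^ 2 + x) L Finset.univ Finset.univ).card := by
    refine lt_of_lt_of_le (mul_pos (by positivity) ?_) hpow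
    exact_mod_cast (SimpleGraph.goodColorings_empty_nonempty L).card_pos
  obtain ⟨c, hc⟩ := Finset.card_pos.1 (Nat.cast_pos.1 hpos)
  obtain ⟨h1, -, h3⟩ := SimpleGraph.mem_goodColorings.1 hc
  exact ⟨c, fun v => h1 v (Finset.mem_univ v),
    fun u w huw => h3.proper u (Finset.mem_univ u) w (Finset.mem_univ w) huw,
    fun v w hw => h3.cycle v w hw fun x _ => Finset.mem_univ x⟩
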